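/- arXiv:2505.08024 — 2 statements merged into one kernel-verified Lean document; each statement's English description precedes it below -/
import Mathlib

section
/- For every natural number k ≥ 1 there exist polynomials c₀, c₁, …, c_{N-1} ∈ ℚ[x] of degree at most k - 1, where N = lcm(1, 2, …, k), such that for every natural number m one has p_k(m) = c_{m mod N}(m); that is, p_k is a quasipolynomial of degree k - 1 and quasiperiod dividing lcm(1,…,k). -/
open Polynomial

/-- `partnum k m = p_k(m)`, the number of partitions of `m` all of whose parts have size
at most `k`. -/
def partnum (k m : ℕ) : ℕ :=
  Fintype.card {p : Nat.Partition m // ∀ j ∈ p.parts, j ≤ k}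

open PowerSeries.WithPiTopology in
/-- The generating function of `partnum k` is inverse to `∏_{j = 1}^k (1 - x^j)`. -/
lemma mk_partnum_mul_prod_one_sub_X_pow (k : ℕ) :
    (PowerSeries.mk fun m ↦ (partnum k m : ℚ)) *
      ∏ j ∈ Finset.Icc 1 k, (1 - (PowerSeries.X : PowerSeries ℚ) ^ j) = 1 := by
  have hcard (m : ℕ) : partnum k m = (Nat.Partition.restricted m (· ≤ k)).card := by
    rw [partnum, Fintype.card_subtype]
    rfl
  have hprod := Nat.Partition.hasProd_powerSeriesMk_card_restricted ℚ (· ≤ k)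
  have hfin := hasProd_prod_of_ne_finset_one (s := Finset.range k)
    (f := fun i ↦ if i + 1 ≤ k then
      ∑' j : ℕ, (PowerSeries.X : PowerSeries ℚ) ^ ((i + 1) * j) else 1) (L := .unconditional ℕ)
    (fun i hi ↦ if_neg (by simpa using hi))
  simp_rw [hcard]
  rw [hprod.unique hfin, Finset.prod_congr rfl fun i hi ↦
    if_pos (Nat.succ_le_of_lt (Finset.mem_range.mp hi)), ← Finset.Ico_add_one_right_eq_Icc,
    Finset.prod_Ico_eq_prod_range, Nat.add_sub_cancel, ← Finset.prod_mul_distrib]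
  refine Finset.prod_eq_one fun i _ ↦ ?_
  rw [add_comm 1 i]
  simp_rw [pow_mul]
  exact tsum_pow_mul_one_sub_of_constantCoeff_eq_zero (by simp)

/-- The polynomial `∏_{j = 1}^k (1 - x^N) / (1 - x^j)`, for `N` divisible by `1, …, k`. -/
noncomputable def cofactorPoly (k N : ℕ) : ℚ[X] :=
  ∏ j ∈ Finset.Icc 1 k, ∑ i ∈ Finset.range (N / j), (X ^ j) ^ i

lemma cofactorPoly_mul_prod_one_sub_X_pow {k N : ℕ} (hN : ∀ j ∈ Finset.Icc 1 k, j ∣ N) :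
    cofactorPoly k N * ∏ j ∈ Finset.Icc 1 k, (1 - X ^ j) = (1 - X ^ N) ^ k := by
  rw [cofactorPoly, ← Finset.prod_mul_distrib, Finset.prod_congr rfl (g := fun _ ↦ 1 - X ^ N)]
  · simp
  · intro j hj
    rw [geom_sum_mul_neg, ← pow_mul, Nat.mul_div_cancel' (hN j hj)]

lemma natDegree_cofactorPoly_lt {k N : ℕ} (hk : 1 ≤ k) (hN : 0 < N) :
    (cofactorPoly k N).natDegree < k * N := by
  have hfactor (j : ℕ) (hj : j ∈ Finset.Icc 1 k) :
      (∑ i ∈ Finset.range (N / j), ((X : ℚ[X]) ^ j) ^ i).natDegree ≤ N - 1 := by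
    refine natDegree_sum_le_of_forall_le _ _ fun i hi ↦ ?_
    rw [← pow_mul, natDegree_X_pow]
    have hj' : 1 ≤ j := (Finset.mem_Icc.mp hj).1
    have hle : j * (i + 1) ≤ N :=
      (Nat.mul_le_mul_left j (Finset.mem_range.mp hi)).trans (Nat.mul_div_le N j)
    rw [mul_add] at hle
    omega
  calc (cofactorPoly k N).natDegree
      ≤ ∑ j ∈ Finset.Icc 1 k, (∑ i ∈ Finset.range (N / j), ((X : ℚ[X]) ^ j) ^ i).natDegree :=
        natDegree_prod_le _ _
    _ ≤ ∑ j ∈ Finset.Icc 1 k, (N - 1) := Finset.sum_le_sum hfactor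
    _ = k * (N - 1) := by simp
    _ < k * N := Nat.mul_lt_mul_of_pos_left (by omega) (by omega)

/-- The generating function of `partnum k` as a polynomial divided by `(1 - x^N)^k`. -/
lemma mk_partnum_eq_cofactorPoly_mul {k N : ℕ} (hN0 : N ≠ 0)
    (hN : ∀ j ∈ Finset.Icc 1 k, j ∣ N) :
    (PowerSeries.mk fun m ↦ (partnum k m : ℚ)) = (cofactorPoly k N : PowerSeries ℚ) *
      PowerSeries.expand N hN0 (PowerSeries.invOneSubPow ℚ k).val := by
  have hP := mk_partnum_mul_prod_one_sub_X_pow k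
  have hQ := congrArg (Polynomial.toPowerSeries) (cofactorPoly_mul_prod_one_sub_X_pow hN)
  have hE : PowerSeries.expand N hN0 (PowerSeries.invOneSubPow ℚ k).val *
      (1 - PowerSeries.X ^ N) ^ k = 1 := by
    have h := congrArg (PowerSeries.expand N hN0) (PowerSeries.invOneSubPow ℚ k).val_inv
    rw [PowerSeries.invOneSubPow_inv_eq_one_sub_pow] at h
    simpa using h
  have hcoe : ((∏ j ∈ Finset.Icc 1 k, (1 - X ^ j) : ℚ[X]) : PowerSeries ℚ) =
      ∏ j ∈ Finset.Icc 1 k, (1 - PowerSeries.X ^ j) := by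
    rw [← Polynomial.coeToPowerSeries.ringHom_apply, map_prod]
    simp
  rw [Polynomial.coe_mul, hcoe] at hQ
  simp only [Polynomial.coe_pow, Polynomial.coe_sub, Polynomial.coe_one, Polynomial.coe_X] at hQ
  rw [← hQ] at hE
  linear_combination (-PowerSeries.mk fun m ↦ (partnum k m : ℚ)) * hE +
    (cofactorPoly k N : PowerSeries ℚ) *
      PowerSeries.expand N hN0 (PowerSeries.invOneSubPow ℚ k).val * hP

lemma preHilbertPoly_eval_neg_eq_zero {d t : ℕ} (ht : 1 ≤ t) (htd : t ≤ d) :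
    (preHilbertPoly ℚ d 0).eval (-(t : ℚ)) = 0 := by
  have h : (ascPochhammer ℚ d).eval (-(t : ℚ) + 1) = 0 := by
    rw [ascPochhammer_eval_eq_zero_iff]
    exact ⟨t - 1, by omega, by push_cast [ht]; ring⟩
  simp [preHilbertPoly, h]

/-- The polynomial in `m` giving, for `m ≡ r` modulo `N`, the coefficient of `x^m` in
`Q(x) / (1 - x^N)^(d + 1)` when `Q` has degree less than `(d + 1) N`. -/
noncomputable def residuePoly (Q : ℚ[X]) (d N r : ℕ) : ℚ[X] :=
  ∑ i ∈ Finset.range ((d + 1) * N), if i % N = r then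
    C (Q.coeff i) * (preHilbertPoly ℚ d 0).comp (C (N : ℚ)⁻¹ * (X - C (i : ℚ))) else 0

lemma natDegree_residuePoly_le (Q : ℚ[X]) (d N r : ℕ) : (residuePoly Q d N r).natDegree ≤ d := by
  refine natDegree_sum_le_of_forall_le _ _ fun i _ ↦ ?_
  split_ifs
  · refine (natDegree_C_mul_le _ _).trans (natDegree_comp_le.trans ?_)
    rw [natDegree_preHilbertPoly]
    refine (Nat.mul_le_mul_left d ((natDegree_C_mul_le _ _).trans ?_)).trans (mul_one d).le
    exact natDegree_X_sub_C_le _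
  · simp

lemma coeff_mul_expand_invOneSubPow {Q : ℚ[X]} {d N : ℕ} (hN : N ≠ 0)
    (hQ : Q.natDegree < (d + 1) * N) (m : ℕ) :
    PowerSeries.coeff m ((Q : PowerSeries ℚ) *
      PowerSeries.expand N hN (PowerSeries.invOneSubPow ℚ (d + 1)).val) =
      (residuePoly Q d N (m % N)).eval (m : ℚ) := by
  have hN' : (N : ℚ) ≠ 0 := Nat.cast_ne_zero.mpr hN
  set F : ℕ → ℚ := fun i ↦ if i % N = m % N then
    Q.coeff i * (preHilbertPoly ℚ d 0).eval ((N : ℚ)⁻¹ * (m - i)) else 0 with hF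
  have hright : (residuePoly Q d N (m % N)).eval (m : ℚ) =
      ∑ i ∈ Finset.range ((d + 1) * N), F i := by
    rw [residuePoly, eval_finsetSum]
    refine Finset.sum_congr rfl fun i _ ↦ ?_
    simp only [hF]
    split_ifs <;> simp
  have hleft : PowerSeries.coeff m ((Q : PowerSeries ℚ) *
      PowerSeries.expand N hN (PowerSeries.invOneSubPow ℚ (d + 1)).val) =
      ∑ i ∈ Finset.range (m + 1), F i := by
    rw [PowerSeries.coeff_mul, Finset.Nat.sum_antidiagonal_eq_sum_range_succ_mk]
    refine Finset.sum_congr rfl fun i hi ↦ ?_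
    have him : i ≤ m := Nat.lt_succ_iff.mp (Finset.mem_range.mp hi)
    have hiff : i % N = m % N ↔ N ∣ m - i := Nat.modEq_iff_dvd' him
    simp only [hF, hiff, Polynomial.coeff_coe, PowerSeries.coeff_expand]
    split_ifs with hdvd
    · obtain ⟨t, ht⟩ := hdvd
      have hcast : (m : ℚ) - i = N * t := by
        rw [← Nat.cast_sub him, ht]
        push_cast
        rfl
      rw [hcast, inv_mul_cancel_left₀ hN', ht, Nat.mul_div_cancel_left t (Nat.pos_of_ne_zero hN),
        preHilbertPoly_eq_choose_sub_add ℚ d (Nat.zero_le t),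
        PowerSeries.invOneSubPow_val_succ_eq_mk_add_choose, PowerSeries.coeff_mk, Nat.sub_zero,
        add_comm d t]
    · simp
  have hvanish (i : ℕ) (hi : m < i) : F i = 0 := by
    simp only [hF]
    split_ifs with hmod
    · obtain hQi | hQi := lt_or_ge Q.natDegree i
      · rw [coeff_eq_zero_of_natDegree_lt hQi, zero_mul]
      · obtain ⟨t, ht⟩ : N ∣ i - m := (Nat.modEq_iff_dvd' hi.le).mp hmod.symm
        have hcast : (m : ℚ) - i = N * -(t : ℚ) := by
          have := congrArg (Nat.cast (R := ℚ)) ht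
          push_cast [hi.le] at this
          linarith
        have ht0 : 1 ≤ t := Nat.one_le_iff_ne_zero.mpr (by rintro rfl; omega)
        have htd : t < d + 1 := by
          refine lt_of_mul_lt_mul_left (a := N) ?_ (Nat.zero_le N)
          rw [← ht, mul_comm N]
          omega
        rw [hcast, inv_mul_cancel_left₀ hN',
          preHilbertPoly_eval_neg_eq_zero ht0 (Nat.lt_succ_iff.mp htd), mul_zero]
    · rfl
  have hdeg (i : ℕ) (hi : (d + 1) * N ≤ i) : F i = 0 := by
    simp [hF, coeff_eq_zero_of_natDegree_lt (hQ.trans_le hi)]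
  have hext {a b : ℕ} (hab : a ≤ b) (h : ∀ i, a ≤ i → F i = 0) :
      ∑ i ∈ Finset.range a, F i = ∑ i ∈ Finset.range b, F i :=
    Finset.sum_subset (Finset.range_mono hab) fun i _ hi ↦ h i (by simpa using hi)
  rw [hleft, hright, hext (le_max_left (m + 1) ((d + 1) * N)) hvanish,
    hext (le_max_right (m + 1) ((d + 1) * N)) hdeg]

/-- For `k ≥ 1`, `p_k` is a quasipolynomial of degree at most `k - 1` with quasiperiod
`N = lcm(1, 2, …, k)`: there are polynomials `c₀, …, c_(N-1) ∈ ℚ[x]` of degree at most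
`k - 1` with `p_k(m) = c_(m mod N)(m)` for all `m`. -/
theorem partnum_quasipolynomial (k : ℕ) (hk : 1 ≤ k) :
    ∃ c : ℕ → Polynomial ℚ,
      (∀ r < (Finset.Icc 1 k).lcm id, (c r).degree ≤ (k - 1 : ℕ)) ∧
      ∀ m : ℕ, (partnum k m : ℚ) = (c (m % (Finset.Icc 1 k).lcm id)).eval (m : ℚ) := by
  have hN0 : (Finset.Icc 1 k).lcm id ≠ 0 := by
    rw [Ne, Finset.lcm_eq_zero_iff]
    simp
  obtain ⟨d, rfl⟩ := Nat.exists_eq_add_of_le' hk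
  set N := (Finset.Icc 1 (d + 1)).lcm id
  refine ⟨residuePoly (cofactorPoly (d + 1) N) d N, fun r _ ↦
    degree_le_of_natDegree_le (natDegree_residuePoly_le _ d N r), fun m ↦ ?_⟩
  rw [← coeff_mul_expand_invOneSubPow hN0
      (natDegree_cofactorPoly_lt hk (Nat.pos_of_ne_zero hN0)) m,
    ← mk_partnum_eq_cofactorPoly_mul hN0 fun j hj ↦ Finset.dvd_lcm (f := id) hj,
    PowerSeries.coeff_mk]
end

section
/- Fix a natural number k ≥ 1. For each n ≥ 1, write binom(n+k,k)_q = a₀(n) + a₁(n)q + ⋯ + a_{nk}(n)q^{nk} and let μ_n be the probability measure on ℝ given by μ_n = (1/C(n+k,k)) ∑_{i=0}^{nk} a_i(n) δ_{i/(nk)}, where δ_t is the Dirac measure at t. Let u : ℝ → ℝ be the indicator function of [0,1] and let u^{*k} denote its k-fold convolution with respect to Lebesgue measure. Then as n → ∞ the measures μ_n converge weakly to the probability measure on ℝ with density x ↦ k·u^{*k}(kx) with respect to Lebesgue measure: for every bounded continuous function f : ℝ → ℝ, ∫ f dμ_n → ∫_ℝ f(x)·k·u^{*k}(kx) dx. 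-/
open Polynomial MeasureTheory Filter
open scoped Convolution

/-- The `q`-integer `[m]_q = 1 + q + q^2 + ⋯ + q^(m-1)` in `ℤ[q]`. -/
noncomputable def qInt (m : ℕ) : Polynomial ℤ := ∑ i ∈ Finset.range m, X ^ i

/-- The `q`-factorial `[m]!_q = [m]_q · [m-1]_q ⋯ [1]_q`, with `[0]!_q = 1`. -/
noncomputable def qFact : ℕ → Polynomial ℤ
  | 0 => 1
  | m + 1 => qInt (m + 1) * qFact m

/-- The indicator function of the interval `[0,1]`. -/
noncomputable def u : ℝ → ℝ := Set.indicator (Set.Icc 0 1) 1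

/-- `convIter u k = u^{*k}`, the `k`-fold convolution of `u` with itself with respect
to Lebesgue measure (with the convention `u^{*0} = 0`). -/
noncomputable def convIter (u : ℝ → ℝ) : ℕ → ℝ → ℝ
  | 0 => fun _ => 0
  | 1 => u
  | k + 2 => convIter u (k + 1) ⋆ u

theorem qInt_add (m l : ℕ) : qInt (m + l) = qInt m + X ^ m * qInt l := by
  simp only [qInt, Finset.sum_range_add, Finset.mul_sum, pow_add]

theorem qInt_eval_one (m : ℕ) : (qInt m).eval 1 = m := by
  simp [qInt, eval_finsetSum]

theorem qFact_eval_one (m : ℕ) : (qFact m).eval 1 = m.factorial := by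
  induction m with
  | zero => simp [qFact]
  | succ m ih => simp [qFact, ih, qInt_eval_one, Nat.factorial_succ]

theorem qFact_ne_zero (m : ℕ) : qFact m ≠ 0 := by
  intro h
  have := qFact_eval_one m
  rw [h, eval_zero] at this
  exact Nat.factorial_ne_zero m (by exact_mod_cast this.symm)

theorem qFact_add (n k : ℕ) :
    qFact (n + k) = (∏ j ∈ Finset.range k, qInt (n + j + 1)) * qFact n := by
  induction k with
  | zero => simp
  | succ k ih => rw [← add_assoc, qFact, ih, Finset.prod_range_succ]; ring

/-- Existence of the Gaussian binomial coefficient, with its degree bound and positivity. -/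
theorem exists_qBinom (n k : ℕ) : ∃ G : ℤ[X], G * qFact k * qFact n = qFact (n + k) ∧
    G.natDegree ≤ n * k ∧ ∀ i, 0 ≤ G.coeff i := by
  have coeff_one_nonneg : ∀ i, 0 ≤ (1 : ℤ[X]).coeff i := fun i ↦ by
    rw [coeff_one]; split_ifs <;> simp
  induction k generalizing n with
  | zero => exact ⟨1, by simp [qFact], by simp, coeff_one_nonneg⟩
  | succ k ihk =>
    induction n with
    | zero => exact ⟨1, by simp [qFact], by simp, coeff_one_nonneg⟩
    | succ n ihn =>
      obtain ⟨A, hA, hAdeg, hApos⟩ := ihn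
      obtain ⟨B, hB, hBdeg, hBpos⟩ := ihk (n + 1)
      refine ⟨A + X ^ (n + 1) * B, ?_, ?_, fun i ↦ ?_⟩
      · have h1 : qFact (n + 1 + (k + 1)) = qInt (n + 1 + (k + 1)) * qFact (n + (k + 1)) := by
          rw [show n + 1 + (k + 1) = n + (k + 1) + 1 by ring, qFact]
        have h2 : n + 1 + k = n + (k + 1) := by ring
        rw [h2] at hB
        rw [h1, qInt_add]
        calc (A + X ^ (n + 1) * B) * qFact (k + 1) * qFact (n + 1)
            = qInt (n + 1) * (A * qFact (k + 1) * qFact n) +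
                X ^ (n + 1) * qInt (k + 1) * (B * qFact k * qFact (n + 1)) := by
              simp only [qFact]; ring
          _ = _ := by rw [hA, hB]; ring
      · refine natDegree_add_le_of_degree_le (hAdeg.trans (by gcongr; omega))
          (natDegree_mul_le.trans ?_)
        rw [natDegree_X_pow]
        linarith
      · rw [coeff_add, coeff_X_pow_mul']
        split_ifs
        · exact add_nonneg (hApos i) (hBpos _)
        · simpa using hApos i

theorem qBinom_mul_prod {n k : ℕ} {P : ℤ[X]} (hP : P * qFact k * qFact n = qFact (n + k)) :
    P * ∏ j ∈ Finset.range k, qInt (j + 1) = ∏ j ∈ Finset.range k, qInt (n + j + 1) := by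
  refine mul_right_cancel₀ (qFact_ne_zero n) ?_
  rw [← qFact_add, ← hP]
  have := qFact_add 0 k
  simp only [zero_add, qFact, mul_one] at this
  rw [this]

theorem qBinom_eval_one {n k : ℕ} {P : ℤ[X]} (hP : P * qFact k * qFact n = qFact (n + k)) :
    P.eval 1 = (n + k).choose k := by
  have h := congrArg (eval 1) hP
  simp only [eval_mul, qFact_eval_one] at h
  have h2 := Nat.add_choose_mul_factorial_mul_factorial n k
  have h3 : ((n + k).choose k : ℤ) * k.factorial * n.factorial = (n + k).factorial := by
    rw [← h2]; push_cast; ring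
  rw [← h3] at h
  have hk : (k.factorial : ℤ) ≠ 0 := by exact_mod_cast k.factorial_ne_zero
  have hn : (n.factorial : ℤ) ≠ 0 := by exact_mod_cast n.factorial_ne_zero
  exact mul_right_cancel₀ hk (mul_right_cancel₀ hn h)

theorem u_nonneg (x : ℝ) : 0 ≤ u x :=
  Set.indicator_nonneg (fun _ _ ↦ zero_le_one) x

theorem integrable_u : Integrable u :=
  (integrable_indicator_iff measurableSet_Icc).2 (by
    change IntegrableOn (fun _ ↦ (1 : ℝ)) _ _
    simp)

theorem convIter_nonneg {g : ℝ → ℝ} (hg : ∀ x, 0 ≤ g x) (k : ℕ) (x : ℝ) :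
    0 ≤ convIter g (k + 1) x := by
  induction k generalizing x with
  | zero => exact hg x
  | succ k ih => exact integral_nonneg fun t ↦ mul_nonneg (ih t) (hg _)

theorem integrable_convIter {g : ℝ → ℝ} (hg : Integrable g) (k : ℕ) :
    Integrable (convIter g (k + 1)) := by
  induction k with
  | zero => exact hg
  | succ k ih => exact ih.integrable_convolution _ hg

theorem integrable_cexp_mul {g : ℝ → ℝ} (hg : Integrable g) (s : ℝ) :
    Integrable fun x : ℝ ↦ Complex.exp (s * x * Complex.I) * (g x : ℂ) := by
  refine hg.ofReal.bdd_mul (c := 1) (by fun_prop) (ae_of_all _ fun x ↦ ?_)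
  rw [← Complex.ofReal_mul, Complex.norm_exp_ofReal_mul_I]

theorem integral_cexp_mul_convolution {g h : ℝ → ℝ} (hg : Integrable g) (hh : Integrable h)
    (s : ℝ) :
    ∫ x : ℝ, Complex.exp (s * x * Complex.I) * ((g ⋆ h) x : ℂ) =
      (∫ x : ℝ, Complex.exp (s * x * Complex.I) * (g x : ℂ)) *
        ∫ x : ℝ, Complex.exp (s * x * Complex.I) * (h x : ℂ) := by
  have := integral_convolution (ContinuousLinearMap.mul ℝ ℂ) (integrable_cexp_mul hg s)
    (integrable_cexp_mul hh s)
  rw [ContinuousLinearMap.mul_apply'] at this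
  rw [← this]
  refine integral_congr_ae (ae_of_all _ fun x ↦ ?_)
  simp only [convolution, ContinuousLinearMap.lsmul_apply, smul_eq_mul,
    ContinuousLinearMap.mul_apply']
  rw [← integral_complex_ofReal, ← integral_const_mul]
  refine integral_congr_ae (ae_of_all _ fun t ↦ ?_)
  have : Complex.exp (s * x * Complex.I) =
      Complex.exp (s * t * Complex.I) * Complex.exp (s * (x - t : ℝ) * Complex.I) := by
    rw [← Complex.exp_add]; congr 1; push_cast; ring
  simp only [this]
  push_cast
  ring

theorem integral_cexp_mul_convIter {g : ℝ → ℝ} (hg : Integrable g) (k : ℕ) (s : ℝ) :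
    ∫ x : ℝ, Complex.exp (s * x * Complex.I) * (convIter g (k + 1) x : ℂ) =
      (∫ x : ℝ, Complex.exp (s * x * Complex.I) * (g x : ℂ)) ^ (k + 1) := by
  induction k with
  | zero => simp [convIter]
  | succ k ih =>
    rw [pow_succ, ← ih]
    exact integral_cexp_mul_convolution (integrable_convIter hg k) hg s

theorem integral_cexp_mul_u (s : ℝ) :
    ∫ x : ℝ, Complex.exp (s * x * Complex.I) * (u x : ℂ) =
      ∫ x in (0 : ℝ)..1, Complex.exp (s * Complex.I * x) := by
  rw [intervalIntegral.integral_of_le zero_le_one, ← integral_Icc_eq_integral_Ioc,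
    ← integral_indicator measurableSet_Icc]
  refine integral_congr_ae (ae_of_all _ fun x ↦ ?_)
  by_cases hx : x ∈ Set.Icc (0 : ℝ) 1
  · simp only [u, Set.indicator_of_mem hx, Pi.one_apply, Complex.ofReal_one, mul_one]
    ring_nf
  · simp [u, Set.indicator_of_notMem hx]

theorem tendsto_mul_cexp_div_sub_one (w : ℂ) :
    Tendsto (fun n : ℕ ↦ (n : ℂ) * (Complex.exp (w / n) - 1)) atTop (nhds w) := by
  have hd : HasDerivAt (fun z : ℂ ↦ Complex.exp (w * z)) w 0 := by
    simpa using ((hasDerivAt_id (0 : ℂ)).const_mul w).cexp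
  have h0 : Tendsto (fun n : ℕ ↦ ((n : ℂ))⁻¹) atTop (nhdsWithin 0 {0}ᶜ) := by
    refine tendsto_nhdsWithin_iff.2 ⟨tendsto_inv_atTop_nhds_zero_nat, ?_⟩
    filter_upwards [eventually_ge_atTop 1] with n hn
    simp; omega
  refine (hd.tendsto_slope_zero.comp h0).congr fun n ↦ ?_
  simp [div_eq_mul_inv]

/-- Normalised geometric sums at `exp (i s / n)` converge to the characteristic function of the
uniform law on `[0,1]`. -/
theorem tendsto_geom_sum_div (s : ℝ) (j : ℕ) :
    Tendsto (fun n : ℕ ↦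
      (∑ i ∈ Finset.range (n + j), Complex.exp (s * Complex.I / n) ^ i) / ((n + j : ℕ) : ℂ))
      atTop (nhds (∫ x in (0 : ℝ)..1, Complex.exp (s * Complex.I * x))) := by
  rcases eq_or_ne s 0 with rfl | hs
  · refine tendsto_const_nhds.congr' ?_
    filter_upwards [eventually_ge_atTop 1] with n hn
    have : ((n : ℂ) + j) ≠ 0 := by norm_cast; omega
    simp [this]
  set w : ℂ := s * Complex.I with hw
  have hw0 : w ≠ 0 := by simp [hw, hs]
  have hinv : Tendsto (fun n : ℕ ↦ w / n) atTop (nhds 0) := by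
    simpa [div_eq_mul_inv] using
      (tendsto_inv_atTop_nhds_zero_nat (𝕜 := ℂ)).const_mul w
  have hexp : Tendsto (fun n : ℕ ↦ Complex.exp (w / n)) atTop (nhds 1) := by
    simpa using hinv.cexp
  have hden : Tendsto (fun n : ℕ ↦ ((n + j : ℕ) : ℂ) * (Complex.exp (w / n) - 1))
      atTop (nhds w) := by
    have := (tendsto_mul_cexp_div_sub_one w).add ((hexp.sub_const 1).const_mul (j : ℂ))
    simp only [sub_self, mul_zero, add_zero] at this
    refine this.congr fun n ↦ ?_
    push_cast; ring
  have hnum : Tendsto (fun n : ℕ ↦ Complex.exp (w / n) ^ (n + j) - 1)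
      atTop (nhds (Complex.exp w - 1)) := by
    have := ((hexp.pow j).const_mul (Complex.exp w)).sub_const 1
    simp only [one_pow, mul_one] at this
    refine this.congr' ?_
    filter_upwards [eventually_ge_atTop 1] with n hn
    have hn0 : (n : ℂ) ≠ 0 := by norm_cast; omega
    rw [pow_add, ← Complex.exp_nat_mul _ n, mul_div_cancel₀ _ hn0]
  have hint : ∫ x in (0 : ℝ)..1, Complex.exp (w * x) = (Complex.exp w - 1) / w := by
    rw [integral_exp_mul_complex hw0]; simp
  rw [hint]
  refine (hnum.div hden hw0).congr' ?_
  filter_upwards [hden.eventually_ne hw0] with n hn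
  have h1 := left_ne_zero_of_mul hn
  have h2 := right_ne_zero_of_mul hn
  simp only [Pi.div_apply]
  rw [← geom_sum_mul]
  field_simp

theorem integral_sum_smul_dirac {ι E : Type*} [NormedAddCommGroup E] [NormedSpace ℝ E]
    [CompleteSpace E] (s : Finset ι) {w : ι → ℝ} (hw : ∀ i, 0 ≤ w i) (x : ι → ℝ) (F : ℝ → E) :
    ∫ y, F y ∂(∑ i ∈ s, ENNReal.ofReal (w i) • Measure.dirac (x i)) = ∑ i ∈ s, w i • F (x i) := by
  rw [integral_finsetSum_measure fun i _ ↦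
    (integrable_dirac (by finiteness)).smul_measure ENNReal.ofReal_ne_top]
  refine Finset.sum_congr rfl fun i _ ↦ ?_
  rw [integral_smul_measure, integral_dirac, ENNReal.toReal_ofReal (hw i)]

theorem integral_withDensity_ofReal {E : Type*} [NormedAddCommGroup E] [NormedSpace ℝ E]
    {ρ : ℝ → ℝ} (hρ : Integrable ρ) (hpos : ∀ x, 0 ≤ ρ x) (F : ℝ → E) :
    ∫ x, F x ∂(volume.withDensity fun x ↦ ENNReal.ofReal (ρ x)) = ∫ x, ρ x • F x := by
  rw [integral_withDensity_eq_integral_toReal_smul₀ hρ.aemeasurable.ennreal_ofReal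
    (ae_of_all _ fun _ ↦ ENNReal.ofReal_lt_top)]
  simp_rw [ENNReal.toReal_ofReal (hpos _)]

theorem aeval_eq_sum_of_natDegree_le {p : ℤ[X]} {N : ℕ} (h : p.natDegree ≤ N) (z : ℂ) :
    aeval z p = ∑ i ∈ Finset.range (N + 1), (p.coeff i : ℂ) * z ^ i := by
  rw [aeval_eq_sum_range' (Nat.lt_succ_of_le h)]
  simp

/-- The characteristic functions of the normalised coefficient measures converge. -/
theorem tendsto_aeval_qBinom_div {k : ℕ} {P : ℕ → ℤ[X]}
    (hP : ∀ n, P n * qFact k * qFact n = qFact (n + k)) (s : ℝ) :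
    Tendsto (fun n : ℕ ↦
      aeval (Complex.exp (s * Complex.I / n)) (P n) / ((n + k).choose k : ℂ)) atTop
      (nhds ((∫ x in (0 : ℝ)..1, Complex.exp (s * Complex.I * x)) ^ k)) := by
  set φ := ∫ x in (0 : ℝ)..1, Complex.exp (s * Complex.I * x)
  set z : ℕ → ℂ := fun n ↦ Complex.exp (s * Complex.I / n)
  have hz1 : Tendsto z atTop (nhds 1) := by
    have : Tendsto (fun n : ℕ ↦ s * Complex.I / n) atTop (nhds 0) := by
      simpa [div_eq_mul_inv] using
        (tendsto_inv_atTop_nhds_zero_nat (𝕜 := ℂ)).const_mul (s * Complex.I)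
    simpa using this.cexp
  have hqInt (y : ℂ) (m : ℕ) : aeval y (qInt m) = ∑ i ∈ Finset.range m, y ^ i := by
    simp [qInt]
  have hnum : Tendsto (fun n ↦ ∏ j ∈ Finset.range k,
      (aeval (z n) (qInt (n + j + 1)) / ((n + j + 1 : ℕ) : ℂ))) atTop (nhds (φ ^ k)) := by
    rw [show φ ^ k = ∏ _j ∈ Finset.range k, φ by simp]
    refine tendsto_finsetProd _ fun j _ ↦ ?_
    simpa only [hqInt, add_assoc] using tendsto_geom_sum_div s (j + 1)
  have hden : Tendsto (fun n ↦ ∏ j ∈ Finset.range k,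
      (aeval (z n) (qInt (j + 1)) / ((j + 1 : ℕ) : ℂ))) atTop (nhds 1) := by
    rw [show (1 : ℂ) = ∏ _j ∈ Finset.range k, 1 by simp]
    refine tendsto_finsetProd _ fun j _ ↦ ?_
    have h : Tendsto (fun n ↦ ∑ i ∈ Finset.range (j + 1), z n ^ i) atTop
        (nhds (∑ i ∈ Finset.range (j + 1), 1 ^ i)) :=
      tendsto_finsetSum _ fun i _ ↦ hz1.pow i
    have h2 := h.div_const ((j + 1 : ℕ) : ℂ)
    have hj : (j : ℂ) + 1 ≠ 0 := by norm_cast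
    simpa [hqInt, hj] using h2
  have hlim := hnum.div hden one_ne_zero
  rw [div_one] at hlim
  refine hlim.congr' ?_
  filter_upwards [hden.eventually_ne one_ne_zero] with n hn
  have hprod := congrArg (aeval (z n)) (qBinom_mul_prod (hP n))
  have hone := congrArg (eval 1) (qBinom_mul_prod (hP n))
  simp only [eval_mul, eval_prod, qInt_eval_one, qBinom_eval_one (hP n)] at hone
  have honeC : ((n + k).choose k : ℂ) * ∏ j ∈ Finset.range k, ((j + 1 : ℕ) : ℂ) =
      ∏ j ∈ Finset.range k, ((n + j + 1 : ℕ) : ℂ) := by exact_mod_cast hone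
  simp only [map_mul, map_prod] at hprod
  rw [Finset.prod_div_distrib] at hn
  simp only [Pi.div_apply, Finset.prod_div_distrib]
  rw [← hprod, ← honeC]
  have h1 : ((n + k).choose k : ℂ) ≠ 0 := by
    exact_mod_cast (Nat.choose_pos (Nat.le_add_left k n)).ne'
  obtain ⟨h2, h3⟩ := div_ne_zero_iff.1 hn
  field_simp
  rfl

/-- Fix `k ≥ 1` and let `P n = binom(n+k,k)_q` with coefficients `a_i(n)`.  The
probability measures `μ_n = (1/C(n+k,k)) ∑_i a_i(n) δ_(i/(nk))` converge weakly, as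
`n → ∞`, to the measure on `ℝ` with density `x ↦ k · u^{*k}(kx)`: for every bounded
continuous `f : ℝ → ℝ`, `∫ f dμ_n → ∫ f(x) · k · u^{*k}(kx) dx`. -/
theorem qbinom_limit_shape (k : ℕ) (hk : 1 ≤ k) (P : ℕ → Polynomial ℤ)
    (hP : ∀ n, P n * qFact k * qFact n = qFact (n + k))
    (f : ℝ → ℝ) (hf : Continuous f) (hbdd : ∃ C, ∀ x, |f x| ≤ C) :
    Tendsto
      (fun n : ℕ =>
        (∑ i ∈ Finset.range (n * k + 1),
            ((P n).coeff i : ℝ) * f ((i : ℝ) / (n * k : ℝ))) / ((n + k).choose k : ℝ))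
      atTop
      (nhds (∫ x : ℝ, f x * (k * convIter u k (k * x)))) := by
  have hk0 : (k : ℝ) ≠ 0 := by norm_cast; omega
  have hPG : ∀ n, (P n).natDegree ≤ n * k ∧ ∀ i, 0 ≤ (P n).coeff i := by
    intro n
    obtain ⟨G, hG, h⟩ := exists_qBinom n k
    have : P n = G := mul_right_cancel₀ (qFact_ne_zero k)
      (mul_right_cancel₀ (qFact_ne_zero n) ((hP n).trans hG.symm))
    rwa [this]
  let w (n i : ℕ) : ℝ := (P n).coeff i / (n + k).choose k
  have hw : ∀ n i, 0 ≤ w n i := fun n i ↦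
    div_nonneg (by exact_mod_cast (hPG n).2 i) (Nat.cast_nonneg _)
  let μ (n : ℕ) : Measure ℝ :=
    ∑ i ∈ Finset.range (n * k + 1), ENNReal.ofReal (w n i) • Measure.dirac ((i : ℝ) / (n * k))
  let ρ (x : ℝ) : ℝ := k * convIter u k (k * x)
  let ν : Measure ℝ := volume.withDensity fun x ↦ ENNReal.ofReal (ρ x)
  obtain ⟨l, rfl⟩ : ∃ l, k = l + 1 := ⟨k - 1, by omega⟩
  have hρpos : ∀ x, 0 ≤ ρ x := fun x ↦
    mul_nonneg (Nat.cast_nonneg _) (convIter_nonneg u_nonneg l _)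
  have hρint : Integrable ρ :=
    ((integrable_convIter integrable_u l).comp_mul_left' hk0).const_mul _
  have hcharν (t : ℝ) : charFun ν t =
      (∫ x in (0 : ℝ)..1, Complex.exp ((t / (l + 1 : ℕ) : ℝ) * Complex.I * x)) ^ (l + 1) := by
    rw [charFun_apply_real, integral_withDensity_ofReal hρint hρpos, ← integral_cexp_mul_u,
      ← integral_cexp_mul_convIter integrable_u]
    have := Measure.integral_comp_mul_left (fun y : ℝ ↦
      Complex.exp ((t / (l + 1 : ℕ) : ℝ) * y * Complex.I) * (convIter u (l + 1) y : ℂ))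
      ((l + 1 : ℕ) : ℝ)
    rw [abs_of_nonneg (by positivity), eq_inv_smul_iff₀ hk0, ← integral_smul] at this
    rw [← this]
    refine integral_congr_ae (ae_of_all _ fun x ↦ ?_)
    have h : ((t / (l + 1 : ℕ) : ℝ) : ℂ) * (((l + 1 : ℕ) : ℝ) * x : ℝ) = t * x := by
      rw [← Complex.ofReal_mul, ← Complex.ofReal_mul]; congr 1; field_simp
    simp only [ρ, h, Complex.real_smul]
    push_cast
    ring
  have hcharμ (n : ℕ) (t : ℝ) : charFun (μ n) t =
      aeval (Complex.exp ((t / (l + 1 : ℕ) : ℝ) * Complex.I / n)) (P n) /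
        ((n + (l + 1)).choose (l + 1) : ℂ) := by
    rw [charFun_apply_real, integral_sum_smul_dirac _ (hw n),
      aeval_eq_sum_of_natDegree_le (hPG n).1, Finset.sum_div]
    refine Finset.sum_congr rfl fun i _ ↦ ?_
    rw [← Complex.exp_nat_mul, Complex.real_smul]
    simp only [w]
    push_cast
    rw [div_mul_eq_mul_div]
    congr 3
    simp only [div_eq_mul_inv, mul_inv]
    ring
  have hμ (n : ℕ) : IsProbabilityMeasure (μ n) := by
    have h1 : ∑ i ∈ Finset.range (n * (l + 1) + 1), w n i = 1 := by
      have h := qBinom_eval_one (hP n)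
      rw [eval_eq_sum_range' (Nat.lt_succ_of_le (hPG n).1)] at h
      simp only [one_pow, mul_one] at h
      have hc : ((n + (l + 1)).choose (l + 1) : ℝ) ≠ 0 := by
        exact_mod_cast (Nat.choose_pos (Nat.le_add_left (l + 1) n)).ne'
      rw [← Finset.sum_div, div_eq_one_iff_eq hc]
      exact_mod_cast h
    constructor
    simp only [μ, Measure.coe_finsetSum, Finset.sum_apply, Measure.smul_apply, measure_univ,
      smul_eq_mul, mul_one]
    rw [← ENNReal.ofReal_sum_of_nonneg fun i _ ↦ hw n i, h1, ENNReal.ofReal_one]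
  have hν : IsProbabilityMeasure ν := by
    have h0 := hcharν 0
    rw [charFun_apply_real, integral_withDensity_ofReal hρint hρpos] at h0
    have h1 : ∫ x, ρ x = 1 := by
      simp only [Complex.ofReal_zero, zero_mul, Complex.exp_zero, Complex.real_smul, mul_one,
        zero_div, intervalIntegral.integral_const, sub_zero, one_smul, one_pow] at h0
      rw [integral_complex_ofReal] at h0
      exact_mod_cast h0
    constructor
    rw [withDensity_apply _ MeasurableSet.univ, Measure.restrict_univ,
      ← ofReal_integral_eq_lintegral_ofReal hρint (ae_of_all _ hρpos), h1, ENNReal.ofReal_one]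
  let M (n : ℕ) : ProbabilityMeasure ℝ := ⟨μ n, hμ n⟩
  let N : ProbabilityMeasure ℝ := ⟨ν, hν⟩
  have hlim : Tendsto M atTop (nhds N) := by
    refine ProbabilityMeasure.tendsto_iff_tendsto_charFun.2 fun t ↦ ?_
    simp only [M, N, ProbabilityMeasure.coe_mk, hcharμ, hcharν]
    exact tendsto_aeval_qBinom_div hP (t / (l + 1 : ℕ))
  obtain ⟨C, hC⟩ := hbdd
  let F : BoundedContinuousFunction ℝ ℝ := .ofNormedAddCommGroup f hf C hC
  have hF := ProbabilityMeasure.tendsto_iff_forall_integral_tendsto.1 hlim F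
  have hFν : ∫ x, F x ∂ν = ∫ x, f x * ((l + 1 : ℕ) * convIter u (l + 1) ((l + 1 : ℕ) * x)) := by
    rw [integral_withDensity_ofReal hρint hρpos]
    exact integral_congr_ae (ae_of_all _ fun x ↦ mul_comm _ _)
  have hFμ (n : ℕ) : ∫ x, F x ∂(μ n) =
      (∑ i ∈ Finset.range (n * (l + 1) + 1),
        ((P n).coeff i : ℝ) * f ((i : ℝ) / (n * (l + 1 : ℕ) : ℝ))) /
          ((n + (l + 1)).choose (l + 1) : ℝ) := by
    rw [integral_sum_smul_dirac _ (hw n), Finset.sum_div]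
    exact Finset.sum_congr rfl fun i _ ↦ div_mul_eq_mul_div _ _ _
  simp only [M, N, ProbabilityMeasure.coe_mk, hFν, hFμ] at hF
  exact hF
end
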